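/- In G = (ℤ/5ℤ)² with standard generators e₁, e₂, consider the triples S = [e₁, e₂, 4e₁+4e₂] and S' = [e₁+3e₂, 2e₁+4e₂, 2e₁+3e₂]. Both are generating triples of G (each entry nonzero, entries sum to 0, and generate G), and the stabilizer sets satisfy Σ_S ∩ Σ_{S'} = {0}, where Σ_T for a triple T = [a,b,c] in the abelian group G is ⟨a⟩ ∪ ⟨b⟩ ∪ ⟨c⟩. -/

import Mathlib

/-- The stabilizer set of a triple `[a,b,c]` in an abelian group:
`Σ = ⟨a⟩ ∪ ⟨b⟩ ∪ ⟨c⟩`. -/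
def stabSet {G : Type*} [AddGroup G] (a b c : G) : Set G :=
  (AddSubgroup.zmultiples a : Set G) ∪ (AddSubgroup.zmultiples b : Set G) ∪
    (AddSubgroup.zmultiples c : Set G)

lemma z5_closure_aux (a b c : ZMod 5 × ZMod 5)
    (h : ∀ x : ZMod 5 × ZMod 5, ∃ m n : Fin 5, m.val • a + n.val • b = x) :
    AddSubgroup.closure {a, b, c} = ⊤ := by
  rw [eq_top_iff]
  intro x _
  obtain ⟨m, n, rfl⟩ := h x
  exact add_mem (nsmul_mem (AddSubgroup.subset_closure (by simp)) _)
    (nsmul_mem (AddSubgroup.subset_closure (by simp)) _)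

lemma z5_zmultiples_aux (a x : ZMod 5 × ZMod 5) (h : x ∈ AddSubgroup.zmultiples a) :
    ∃ n : ZMod 5, x = (n * a.1, n * a.2) := by
  obtain ⟨k, rfl⟩ := AddSubgroup.mem_zmultiples_iff.1 h
  exact ⟨k, by ext <;> simp⟩

lemma z5_stab_aux (a b c x : ZMod 5 × ZMod 5) (h : x ∈ stabSet a b c) :
    ∃ n : ZMod 5, x = (n * a.1, n * a.2) ∨ x = (n * b.1, n * b.2) ∨ x = (n * c.1, n * c.2) := by
  rcases h with (h | h) | h <;> obtain ⟨n, hn⟩ := z5_zmultiples_aux _ _ h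
  · exact ⟨n, Or.inl hn⟩
  · exact ⟨n, Or.inr (Or.inl hn)⟩
  · exact ⟨n, Or.inr (Or.inr hn)⟩

theorem beauville_structure_Z5_squared :
    let G := ZMod 5 × ZMod 5
    let a₁ : G := (1, 0)          -- e₁
    let b₁ : G := (0, 1)          -- e₂
    let c₁ : G := (4, 4)          -- 4e₁ + 4e₂
    let a₂ : G := (1, 3)          -- e₁ + 3e₂
    let b₂ : G := (2, 4)          -- 2e₁ + 4e₂
    let c₂ : G := (2, 3)          -- 2e₁ + 3e₂
    (a₁ ≠ 0 ∧ b₁ ≠ 0 ∧ c₁ ≠ 0 ∧ a₁ + b₁ + c₁ = 0 ∧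
      AddSubgroup.closure {a₁, b₁, c₁} = ⊤) ∧
    (a₂ ≠ 0 ∧ b₂ ≠ 0 ∧ c₂ ≠ 0 ∧ a₂ + b₂ + c₂ = 0 ∧
      AddSubgroup.closure {a₂, b₂, c₂} = ⊤) ∧
    stabSet a₁ b₁ c₁ ∩ stabSet a₂ b₂ c₂ = {0} := by
  intro G a₁ b₁ c₁ a₂ b₂ c₂
  refine ⟨⟨by decide, by decide, by decide, by decide, z5_closure_aux _ _ _ (by decide)⟩,
    ⟨by decide, by decide, by decide, by decide, z5_closure_aux _ _ _ (by decide)⟩, ?_⟩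
  ext x
  constructor
  · rintro ⟨h, h'⟩
    have h1 := z5_stab_aux _ _ _ _ h
    have h2 := z5_stab_aux _ _ _ _ h'
    clear h h'
    rw [Set.mem_singleton_iff]
    revert x
    decide
  · rintro rfl
    exact ⟨Or.inl (Or.inl (zero_mem _)), Or.inl (Or.inl (zero_mem _))⟩
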